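/- Let E ≥ 2, R ≥ E − 1, and K ≥ 1 be integers; let L > 0, V > 0, σ ≥ 0, B ≥ 0, H ≥ 0 be real numbers; and let η ≥ 0 satisfy η² ≤ 1/(24·E·R·V·L²). Let x₀, x₁, …, x_E be nonnegative real numbers with x₀ = 0 and, for every l ∈ {1, …, E}, x_l ≤ (1 + 1/(2E−1) + 12·E·V·L²·η²)·x_{l−1} + η²·σ² + 6·E·η²·(B² + 3H²). Then x_l ≤ 5·E·η²·(σ² + 6·E·B² + 18·E·H²) for every l ∈ {0, 1, …, E}. -/

import Mathlib

/-- `(1 + 1/n)^(n+1)` is at most `6` for every positive integer `n`. -/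
theorem one_add_inv_pow_succ_le_six {n : ℕ} (hn : 1 ≤ n) :
    (1 + 1 / (n : ℝ)) ^ (n + 1) ≤ 6 := by
  have hn' : (1 : ℝ) ≤ n := by exact_mod_cast hn
  have hle : (1 + 1 / (n : ℝ)) ^ n ≤ Real.exp 1 := by
    calc (1 + 1 / (n : ℝ)) ^ n ≤ Real.exp (1 / n) ^ n := by
          gcongr
          linarith [Real.add_one_le_exp (1 / (n : ℝ))]
      _ = Real.exp 1 := by
          rw [← Real.exp_nat_mul]
          congr 1
          field_simp
  have hinv : 1 / (n : ℝ) ≤ 1 := (div_le_one (by linarith)).2 hn'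
  calc (1 + 1 / (n : ℝ)) ^ (n + 1) = (1 + 1 / (n : ℝ)) ^ n * (1 + 1 / (n : ℝ)) := pow_succ _ _
    _ ≤ Real.exp 1 * 2 := by gcongr; linarith
    _ ≤ 6 := by linarith [Real.exp_one_lt_d9]

/-- Discrete Grönwall: if `x 0 = 0` and `x (l + 1) ≤ (1 + 1/n) x l + c` for `l < N`, then
`x l ≤ n c ((1 + 1/n)^l - 1)` for `l ≤ N`. -/
theorem le_of_affine_recursion {n c : ℝ} (hn : 0 < n) {N : ℕ} {x : ℕ → ℝ} (hx0 : x 0 = 0)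
    (h : ∀ l < N, x (l + 1) ≤ (1 + 1 / n) * x l + c) :
    ∀ l ≤ N, x l ≤ n * c * ((1 + 1 / n) ^ l - 1) := by
  intro l
  induction l with
  | zero => simp [hx0]
  | succ l ih =>
    intro hl
    calc x (l + 1) ≤ (1 + 1 / n) * x l + c := h l hl
      _ ≤ (1 + 1 / n) * (n * c * ((1 + 1 / n) ^ l - 1)) + c := by
          gcongr
          exact ih (by lia)
      _ = n * c * ((1 + 1 / n) ^ (l + 1) - 1) := by
          rw [pow_succ]
          field_simp
          ring

/-- Arithmetic core of Lemma 1: under the learning-rate restriction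
`η² ≤ 1/(24ERVL²)`, the drift recursion
`x l ≤ (1 + 1/(2E−1) + 12EVL²η²)·x (l−1) + η²σ² + 6Eη²(B² + 3H²)` with `x 0 = 0`
yields `x l ≤ 5Eη²(σ² + 6EB² + 18EH²)` for every `l ≤ E`. -/
theorem stmt_7 (E R K : ℕ) (hE : 2 ≤ E) (hR : (E : ℝ) - 1 ≤ (R : ℝ)) (hK : 1 ≤ K)
    (L V σ B H : ℝ) (hL : 0 < L) (hV : 0 < V) (hσ : 0 ≤ σ) (hB : 0 ≤ B) (hH : 0 ≤ H)
    (η : ℝ) (hη0 : 0 ≤ η) (hη : η ^ 2 ≤ 1 / (24 * (E : ℝ) * (R : ℝ) * V * L ^ 2))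
    (x : ℕ → ℝ) (hx0 : x 0 = 0)
    (hnonneg : ∀ l, l ≤ E → 0 ≤ x l)
    (hrec : ∀ l, 1 ≤ l → l ≤ E →
      x l ≤ (1 + 1 / (2 * (E : ℝ) - 1) + 12 * (E : ℝ) * V * L ^ 2 * η ^ 2) * x (l - 1)
        + η ^ 2 * σ ^ 2 + 6 * (E : ℝ) * η ^ 2 * (B ^ 2 + 3 * H ^ 2)) :
    ∀ l, l ≤ E →
      x l ≤ 5 * (E : ℝ) * η ^ 2 * (σ ^ 2 + 6 * (E : ℝ) * B ^ 2 + 18 * (E : ℝ) * H ^ 2) := by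
  obtain ⟨n, rfl⟩ : ∃ n, E = n + 1 := ⟨E - 1, by lia⟩
  have hn1 : 1 ≤ n := by lia
  have hn : (1 : ℝ) ≤ n := by exact_mod_cast hn1
  have hn0 : (0 : ℝ) < n := by linarith
  push_cast at hR hη hrec ⊢
  have hnR : (n : ℝ) ≤ R := by linarith
  have hR0 : (0 : ℝ) < R := by linarith
  have hstep : 12 * ((n : ℝ) + 1) * V * L ^ 2 * η ^ 2 ≤ 1 / (2 * n) := by
    rw [le_div_iff₀ (by positivity)] at hη ⊢
    calc 12 * ((n : ℝ) + 1) * V * L ^ 2 * η ^ 2 * (2 * n)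
        ≤ 12 * ((n : ℝ) + 1) * V * L ^ 2 * η ^ 2 * (2 * R) := by gcongr
      _ = η ^ 2 * (24 * ((n : ℝ) + 1) * R * V * L ^ 2) := by ring
      _ ≤ 1 := hη
  have hrate : 1 / (2 * ((n : ℝ) + 1) - 1) ≤ 1 / (2 * n) :=
    one_div_le_one_div_of_le (by positivity) (by linarith)
  have hfactor : 1 + 1 / (2 * ((n : ℝ) + 1) - 1) + 12 * ((n : ℝ) + 1) * V * L ^ 2 * η ^ 2
      ≤ 1 + 1 / (n : ℝ) := by
    have hhalf : 1 / (2 * (n : ℝ)) + 1 / (2 * n) = 1 / n := by field_simp; norm_num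
    linarith
  set c : ℝ := η ^ 2 * σ ^ 2 + 6 * ((n : ℝ) + 1) * η ^ 2 * (B ^ 2 + 3 * H ^ 2) with hc
  have hc0 : 0 ≤ c := by positivity
  intro l hl
  have hdrift := le_of_affine_recursion (c := c) hn0 hx0 (N := n + 1) (fun l hl => by
    have hl' := hrec (l + 1) (by lia) hl
    rw [Nat.add_sub_cancel] at hl'
    linarith [mul_le_mul_of_nonneg_right hfactor (hnonneg l hl.le)]) l hl
  have hpow : (1 + 1 / (n : ℝ)) ^ l ≤ 6 :=
    (pow_le_pow_right₀ (le_add_of_nonneg_right (by positivity)) hl).trans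
      (one_add_inv_pow_succ_le_six hn1)
  calc x l ≤ n * c * ((1 + 1 / (n : ℝ)) ^ l - 1) := hdrift
    _ ≤ n * c * 5 := by gcongr; linarith
    _ ≤ (n + 1) * c * 5 := by gcongr; linarith
    _ = _ := by rw [hc]; ring
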